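/- Let S be a real 2n×2n symplectic matrix. Then the multiplicity of 1 as a root of the characteristic polynomial of S is even (in particular, it is even also when 1 is not an eigenvalue, the multiplicity then being 0). -/

import Mathlib

open Matrix

/-- The standard symplectic matrix `J = [[0, I], [-I, 0]]` (in `n × n` blocks). -/
noncomputable def stdJ (n : ℕ) : Matrix (Fin n ⊕ Fin n) (Fin n ⊕ Fin n) ℝ :=
  Matrix.fromBlocks 0 1 (-1) 0

/-- A real `2n × 2n` matrix is symplectic if `Sᵀ J S = J`. -/
def IsSymplectic {n : ℕ} (S : Matrix (Fin n ⊕ Fin n) (Fin n ⊕ Fin n) ℝ) : Prop :=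
  Sᵀ * stdJ n * S = stdJ n

/-- The symplectic Cayley transform `M_S = (1/2) J (S + I) (S - I)⁻¹`. -/
noncomputable def cayley {n : ℕ} (S : Matrix (Fin n ⊕ Fin n) (Fin n ⊕ Fin n) ℝ) :
    Matrix (Fin n ⊕ Fin n) (Fin n ⊕ Fin n) ℝ :=
  ((1 : ℝ) / 2) • (stdJ n * (S + 1) * (S - 1)⁻¹)

open Polynomial in
/-- A real polynomial equal to its own reverse has `1` as a root of even multiplicity. -/
theorem even_rootMultiplicity_one_of_reverse_eq_self {p : ℝ[X]} (hp : p ≠ 0)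
    (hrev : p.reverse = p) : Even (p.rootMultiplicity 1) := by
  obtain ⟨q, hpq, hq⟩ := exists_eq_pow_rootMultiplicity_mul_and_not_dvd p hp 1
  set k := p.rootMultiplicity 1
  by_contra hk
  rw [Nat.not_even_iff_odd] at hk
  have hlin : (X - C 1 : ℝ[X]).reverse = -(X - C 1) := by
    have h := reverse_add_C (X : ℝ[X]) (-1)
    have hX : (X : ℝ[X]).reverse = 1 := by
      rw [← one_mul (X : ℝ[X]), reverse_mul_X, ← C_1, reverse_C]
    rw [hX, natDegree_X, C_neg, ← sub_eq_add_neg] at h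
    rw [h, C_1]
    ring
  have hpow : ∀ m : ℕ, ((X - C 1 : ℝ[X]) ^ m).reverse = (-(X - C 1)) ^ m := by
    intro m
    induction m with
    | zero => simpa using reverse_C (1 : ℝ)
    | succ m ih => rw [pow_succ, reverse_mul_of_domain, ih, hlin, pow_succ]
  have hqrev : q.reverse = -q := by
    have h : (X - C 1 : ℝ[X]) ^ k * q.reverse = (X - C 1) ^ k * -q := by
      have h' := hrev
      rw [hpq, reverse_mul_of_domain, hpow, hk.neg_pow] at h'
      linear_combination -h'
    exact mul_left_cancel₀ (pow_ne_zero _ (X_sub_C_ne_zero 1)) h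
  have heval : q.reverse.eval 1 = q.eval 1 := by
    let : Invertible (1 : ℝ) := invertibleOne
    simpa [eval₂_id] using eval₂_reverse_mul_pow (RingHom.id ℝ) 1 q
  refine hq (dvd_iff_isRoot.2 ?_)
  rw [hqrev, eval_neg] at heval
  exact self_eq_neg.1 heval.symm

/-- The characteristic polynomial of a symplectic matrix is palindromic. -/
theorem IsSymplectic.reverse_charpoly {n : ℕ}
    {S : Matrix (Fin n ⊕ Fin n) (Fin n ⊕ Fin n) ℝ} (hS : IsSymplectic S) :
    S.charpoly.reverse = S.charpoly := by
  have hJ : stdJ n = -Matrix.J (Fin n) ℝ := by simp [stdJ, Matrix.J, Matrix.fromBlocks_neg]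
  have hmem : S ∈ Matrix.symplecticGroup (Fin n) ℝ := by
    rw [SymplecticGroup.mem_iff']
    simpa [IsSymplectic, hJ] using hS
  have hdet : S.det = 1 := SymplecticGroup.det_eq_one hmem
  have hinv : S⁻¹.charpoly = S.charpoly := by
    have hu : IsUnit (Matrix.J (Fin n) ℝ) :=
      (Matrix.isUnit_iff_isUnit_det _).2 (Matrix.isUnit_det_J _ _)
    obtain ⟨u, hu⟩ := hu
    have h : S⁻¹ = u.val⁻¹ * Sᵀ * u.val := by
      rw [hu, Matrix.J_inv]
      refine Matrix.inv_eq_left_inv ?_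
      simpa using SymplecticGroup.inv_left_mul_aux hmem
    rw [h, Matrix.charpoly_units_conj', Matrix.charpoly_transpose]
  have h := Matrix.charpoly_inv S ((Matrix.isUnit_iff_isUnit_det S).2 (by simp [hdet]))
  rw [hinv, hdet] at h
  rw [Matrix.reverse_charpoly, h]
  simp [← two_mul]

theorem even_rootMultiplicity_one_charpoly {n : ℕ}
    (S : Matrix (Fin n ⊕ Fin n) (Fin n ⊕ Fin n) ℝ) (hS : IsSymplectic S) :
    Even (Polynomial.rootMultiplicity 1 S.charpoly) := by
  exact even_rootMultiplicity_one_of_reverse_eq_self S.charpoly_monic.ne_zero hS.reverse_charpoly
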